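/- arXiv:2310.06986 — 2 statements merged into one kernel-verified Lean document; each statement's English description precedes it below -/
import Mathlib

section
/- For types ω₁, ω₂ ∈ {I, II} and all admissible indices (for type I: first index ≥ 1, second index ≥ 2; for type II: first index ≥ 2, second index ≥ 1), the auxiliary H(curl) fields on the square and the dual candidates are biorthogonal: ∫_□ ṽ^{ω₁}_{ij}(x,y) · b̃^{ω₂}_{kl}(x,y) dx dy = 0 unless (i, j, ω₁) = (k, l, ω₂). Moreover the diagonal values are ∫_□ ṽ^I_{ij} · b̃^I_{ij} dx dy = −8/( (2i−1) j (2j−1) ) and ∫_□ ṽ^II_{ij} · b̃^II_{ij} dx dy = −8/( i (2i−1) (2j−1) ), where · denotes the Euclidean dot product in ℝ². -/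
open MeasureTheory

/-- Jacobi polynomial `P_n^{(a,b)}` via the Rodrigues formula (on `(-1,1)`). -/
noncomputable def jacobiP (n a b : ℕ) (x : ℝ) : ℝ :=
  (1 / ((2:ℝ)^n * (Nat.factorial n : ℝ) * (1 - x)^a * (1 + x)^b)) *
    iteratedDeriv n (fun t : ℝ => (1 - t)^a * (1 + t)^b * (t^2 - 1)^n) x

/-- Legendre polynomial `L_n = P_n^{(0,0)}`. -/
noncomputable def legendreP (n : ℕ) (x : ℝ) : ℝ := jacobiP n 0 0 x

/-- Integrated Jacobi polynomial `P̂_n^a(x) = ∫_{-1}^x P_{n-1}^{(a,0)}(t) dt`. -/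
noncomputable def intJacobiP (n a : ℕ) (x : ℝ) : ℝ :=
  ∫ t in (-1:ℝ)..x, jacobiP (n - 1) a 0 t

/-- Integrated Legendre polynomial `L̂_n`. -/
noncomputable def intLegendreP (n : ℕ) (x : ℝ) : ℝ := intJacobiP n 0 x

/-- The open reference square `(-1,1)²`. -/
def Sq : Set (ℝ × ℝ) := Set.Ioo (-1:ℝ) 1 ×ˢ Set.Ioo (-1:ℝ) 1

/-- Euclidean dot product in `ℝ²`. -/
def dot2 (p q : ℝ × ℝ) : ℝ := p.1 * q.1 + p.2 * q.2

/-- Auxiliary `H(curl)` interior field of type I on the square. -/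
noncomputable def vtSqI (i j : ℕ) (p : ℝ × ℝ) : ℝ × ℝ :=
  (legendreP (i-1) p.1 * intLegendreP j p.2, 0)

/-- Auxiliary `H(curl)` interior field of type II on the square. -/
noncomputable def vtSqII (i j : ℕ) (p : ℝ × ℝ) : ℝ × ℝ :=
  (0, intLegendreP i p.1 * legendreP (j-1) p.2)

/-- Dual candidate of type I on the square. -/
noncomputable def btSqI (k l : ℕ) (p : ℝ × ℝ) : ℝ × ℝ :=
  (legendreP (k-1) p.1 * jacobiP (l-2) 1 1 p.2, 0)

/-- Dual candidate of type II on the square. -/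
noncomputable def btSqII (k l : ℕ) (p : ℝ × ℝ) : ℝ × ℝ :=
  (0, jacobiP (k-2) 1 1 p.1 * legendreP (l-1) p.2)

open Polynomial in
noncomputable def dF (n k : ℕ) : ℝ[X] := derivative^[k] ((X ^ 2 - 1) ^ n)

open Polynomial in
noncomputable def JJ (p : ℝ[X]) : ℝ := ∫ x in (-1:ℝ)..1, p.eval x

open Polynomial in
lemma JJ_add (p q : ℝ[X]) : JJ (p + q) = JJ p + JJ q := by
  simp only [JJ, eval_add]
  exact intervalIntegral.integral_add (p.continuous.intervalIntegrable _ _)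
    (q.continuous.intervalIntegrable _ _)

open Polynomial in
lemma JJ_C (c : ℝ) (p : ℝ[X]) : JJ (C c * p) = c * JJ p := by
  simp [JJ]

open Polynomial in
lemma JJ_deriv (p : ℝ[X]) : JJ (derivative p) = p.eval 1 - p.eval (-1) := by
  unfold JJ
  exact intervalIntegral.integral_eq_sub_of_hasDerivAt (fun x _ => p.hasDerivAt x)
    ((derivative p).continuous.intervalIntegrable _ _)

open Polynomial in
lemma dF_succ (n k : ℕ) : dF n (k+1) = derivative (dF n k) := by
  simp [dF, Function.iterate_succ_apply']

open Polynomial in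
lemma dF_eval (n k : ℕ) (h : k < n) (x : ℝ) (hx : x ^ 2 = 1) : (dF n k).eval x = 0 := by
  have h1 : (X ^ 2 - 1 : ℝ[X]) ^ (n - k) ∣ dF n k := pow_sub_dvd_iterate_derivative_pow _ n k
  have h2 : (X ^ 2 - 1 : ℝ[X]) ∣ dF n k := (dvd_pow_self _ (by omega)).trans h1
  obtain ⟨q, hq⟩ := h2
  rw [hq]; simp [hx]

open Polynomial in
lemma JJ_parts (n k : ℕ) (h : k < n) (g : ℝ[X]) :
    JJ (dF n (k+1) * g) = - JJ (dF n k * derivative g) := by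
  have := JJ_deriv (dF n k * g)
  rw [derivative_mul, JJ_add, ← dF_succ, eval_mul, eval_mul, dF_eval n k h 1 (by norm_num),
    dF_eval n k h (-1) (by norm_num)] at this
  linarith

open Polynomial in
lemma JJ_parts_iter (n : ℕ) (k : ℕ) : ∀ (_ : k ≤ n) (g : ℝ[X]),
    JJ (dF n k * g) = (-1) ^ k * JJ ((X ^ 2 - 1) ^ n * derivative^[k] g) := by
  induction k with
  | zero => intro _ g; simp [dF]
  | succ k ih =>
    intro h g
    rw [JJ_parts n k (by omega), ih (by omega), Function.iterate_succ_apply]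
    ring

open Polynomial in
lemma W_monic : (X ^ 2 - 1 : ℝ[X]).Monic := by
  simpa using monic_X_pow_sub_C (1:ℝ) (n := 2) (by norm_num)

open Polynomial in
lemma W_deg (n : ℕ) : ((X ^ 2 - 1 : ℝ[X]) ^ n).natDegree = 2 * n := by
  rw [natDegree_pow]
  have : (X ^ 2 - 1 : ℝ[X]).natDegree = 2 := by
    simpa using natDegree_X_pow_sub_C (n := 2) (r := (1:ℝ))
  rw [this]; ring

open Polynomial in
lemma dF_top (n : ℕ) : dF n (2 * n) = C ((2 * n).factorial : ℝ) := by
  have hd : (dF n (2*n)).natDegree = 0 := by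
    have := natDegree_iterate_derivative ((X ^ 2 - 1 : ℝ[X]) ^ n) (2*n)
    rw [W_deg] at this
    unfold dF; omega
  rw [eq_C_of_natDegree_eq_zero hd]
  congr 1
  have hm : ((X ^ 2 - 1 : ℝ[X]) ^ n).coeff (2 * n) = 1 := by
    have := (W_monic.pow n).coeff_natDegree
    rwa [W_deg] at this
  rw [dF, coeff_iterate_derivative]
  simp [hm, Nat.descFactorial_self]

open Polynomial in
lemma JJ_W (n : ℕ) : JJ ((X ^ 2 - 1) ^ n) * ((2 * n + 1).factorial : ℝ)
    = (-1) ^ n * 2 ^ (2 * n + 1) * (n.factorial : ℝ) ^ 2 := by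
  induction n with
  | zero => simp [JJ]; norm_num
  | succ n ih =>
    have h := JJ_deriv (X * (X ^ 2 - 1) ^ (n+1))
    have e : derivative (X * (X ^ 2 - 1 : ℝ[X]) ^ (n+1)) =
        C (2 * n + 3 : ℝ) * (X ^ 2 - 1) ^ (n+1) + C (2 * (n + 1) : ℝ) * (X ^ 2 - 1) ^ n := by
      simp only [derivative_mul, derivative_X, derivative_pow, derivative_sub, derivative_one,
        Nat.add_sub_cancel, map_add, map_mul, map_natCast, map_ofNat, map_one]
      push_cast
      ring
    rw [e, JJ_add, JJ_C, JJ_C] at h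
    simp at h
    have e2 : 2 * (n + 1) + 1 = (2 * n + 1) + 1 + 1 := by ring
    rw [e2, Nat.factorial_succ, Nat.factorial_succ (2 * n + 1), Nat.factorial_succ n]
    push_cast
    linear_combination (2 * (n:ℝ) + 2) * ((2 * n + 1).factorial : ℝ) * h
      - (2 * ((n:ℝ) + 1)) * (2 * (n:ℝ) + 2) * ih

open Polynomial in
lemma JJ_orth (m n : ℕ) (h : m < n) : JJ (dF n n * dF m m) = 0 := by
  rw [JJ_parts_iter n n le_rfl]
  have : derivative^[n] (dF m m) = 0 := by
    apply iterate_derivative_eq_zero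
    have := natDegree_iterate_derivative ((X ^ 2 - 1 : ℝ[X]) ^ m) m
    rw [W_deg] at this
    unfold dF; omega
  rw [this]; simp [JJ]

open Polynomial in
lemma JJ_norm (n : ℕ) : JJ (dF n n * dF n n) = (2 ^ n * (n.factorial : ℝ)) ^ 2 * (2 / (2 * n + 1)) := by
  rw [JJ_parts_iter n n le_rfl]
  have : derivative^[n] (dF n n) = C ((2 * n).factorial : ℝ) := by
    rw [← dF_top, dF, dF, ← Function.iterate_add_apply]; congr 2; ring
  rw [this, mul_comm _ (C _), JJ_C]
  have h := JJ_W n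
  rw [Nat.factorial_succ] at h
  push_cast at h
  have h0 : (2 * (n:ℝ) + 1) ≠ 0 := by positivity
  have h1 : ((-1:ℝ) ^ n) * (-1) ^ n = 1 := by rw [← mul_pow]; simp
  field_simp
  linear_combination (-1) ^ n * h + 2 ^ (2 * n + 1) * (n.factorial : ℝ) ^ 2 * h1

open Polynomial in
lemma dF_ode (n k : ℕ) : (X ^ 2 - 1) * dF n (k+2) =
    C (2 * n - 2 * (k + 1) : ℝ) * (X * dF n (k+1)) + C ((k+1) * (2 * n - k) : ℝ) * dF n k := by
  induction k with
  | zero =>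
    have h0 : (X ^ 2 - 1) * dF n 1 = C (2 * n : ℝ) * (X * dF n 0) := by
      rcases n with _ | n
      · simp [dF]
      · simp [dF, derivative_pow]; ring
    have := congrArg derivative h0
    simp only [derivative_mul, derivative_add, derivative_sub, derivative_X_pow, derivative_one,
      derivative_natCast, derivative_ofNat, derivative_X, ← dF_succ, map_add, map_sub, map_mul, map_natCast, map_ofNat,
      map_one] at this
    simp only [map_add, map_sub, map_mul, map_natCast, map_ofNat, map_one]
    push_cast at this ⊢
    linear_combination this
  | succ k ih =>
    have := congrArg derivative ih
    simp only [derivative_mul, derivative_add, derivative_sub, derivative_X_pow, derivative_one,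
      derivative_natCast, derivative_ofNat, derivative_X, ← dF_succ, map_add, map_sub, map_mul, map_natCast, map_ofNat,
      map_one] at this
    simp only [map_add, map_sub, map_mul, map_natCast, map_ofNat, map_one]
    push_cast at this ⊢
    linear_combination this

open Polynomial in
lemma dF_ode' (n : ℕ) : (X ^ 2 - 1) * dF (n+1) (n+2) = C ((n+1) * (n+2) : ℝ) * dF (n+1) n := by
  have := dF_ode (n+1) n
  simp only [map_add, map_sub, map_mul, map_natCast, map_ofNat, map_one] at this ⊢
  push_cast at this
  linear_combination this

open Polynomial in
lemma iteratedDeriv_poly (p : ℝ[X]) (k : ℕ) (x : ℝ) :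
    iteratedDeriv k (fun t => p.eval t) x = (derivative^[k] p).eval x := by
  induction k generalizing x with
  | zero => simp
  | succ k ih =>
    rw [iteratedDeriv_succ, funext ih, Function.iterate_succ_apply', Polynomial.deriv]

open Polynomial in
lemma leg_eq (n : ℕ) (x : ℝ) : legendreP n x = (dF n n).eval x / (2 ^ n * n.factorial) := by
  have := iteratedDeriv_poly ((X ^ 2 - 1) ^ n) n x
  simp only [eval_pow, eval_sub, eval_X, eval_one] at this
  simp only [legendreP, jacobiP, pow_zero, one_mul, mul_one, this, dF]
  ring

open Polynomial in
lemma intLeg_eq (n : ℕ) (x : ℝ) :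
    intLegendreP (n+2) x = (dF (n+1) n).eval x / (2 ^ (n+1) * (n+1).factorial) := by
  have h : ∀ t, jacobiP (n+2-1) 0 0 t = (dF (n+1) (n+1)).eval t / (2 ^ (n+1) * (n+1).factorial) :=
    fun t => leg_eq (n+1) t
  simp only [intLegendreP, intJacobiP, h]
  rw [intervalIntegral.integral_div]
  congr 1
  rw [dF_succ, intervalIntegral.integral_eq_sub_of_hasDerivAt
    (fun x _ => (dF (n+1) n).hasDerivAt x)
    ((derivative _).continuous.intervalIntegrable _ _), dF_eval _ _ (by omega) (-1) (by norm_num)]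
  simp

open Polynomial in
lemma jac_eq (n : ℕ) (x : ℝ) (hx : x ∈ Set.Ioo (-1:ℝ) 1) :
    jacobiP n 1 1 x = (2 / (n + 2)) * (dF (n+1) (n+2)).eval x / (2 ^ (n+1) * (n+1).factorial) := by
  have h1 := iteratedDeriv_poly (-((X ^ 2 - 1) ^ (n+1))) n x
  have h2 : (fun t : ℝ => (1 - t)^1 * (1 + t)^1 * (t^2 - 1)^n) =
      fun t => (-((X ^ 2 - 1 : ℝ[X]) ^ (n+1))).eval t := by
    funext t; simp; ring
  have h3 : iteratedDeriv n (fun t : ℝ => (1 - t)^1 * (1 + t)^1 * (t^2 - 1)^n) x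
      = - (dF (n+1) n).eval x := by
    rw [h2, h1, iterate_derivative_neg, eval_neg]; rfl
  have h4 := congrArg (eval x) (dF_ode' n)
  simp at h4
  have ha : 1 - x ≠ 0 := by linarith [hx.2] |> fun (h : 0 < 1 - x) => h.ne'
  have hb : 1 + x ≠ 0 := by linarith [hx.1] |> fun (h : 0 < 1 + x) => h.ne'
  rw [jacobiP, h3, Nat.factorial_succ]
  push_cast
  have hc : ((n:ℝ) + 2) ≠ 0 := by positivity
  have hd : ((n:ℝ) + 1) ≠ 0 := by positivity
  field_simp
  linear_combination (2 * 2 ^ n) * h4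

lemma Ioo_JJ (p : Polynomial ℝ) : ∫ x in Set.Ioo (-1:ℝ) 1, p.eval x = JJ p := by
  rw [JJ, intervalIntegral.integral_of_le (by norm_num), integral_Ioc_eq_integral_Ioo]

lemma leg_int (m n : ℕ) : ∫ x in Set.Ioo (-1:ℝ) 1, legendreP m x * legendreP n x =
    if m = n then 2 / (2 * (n:ℝ) + 1) else 0 := by
  have : ∀ x, legendreP m x * legendreP n x =
      (dF m m * dF n n).eval x / ((2 ^ m * m.factorial) * (2 ^ n * n.factorial)) := by
    intro x; rw [leg_eq, leg_eq, Polynomial.eval_mul]; ring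
  simp only [this]
  rw [integral_div, Ioo_JJ]
  split_ifs with h
  · subst h
    rw [JJ_norm]; field_simp
  · rcases Nat.lt_or_gt_of_ne h with h | h
    · rw [mul_comm, JJ_orth _ _ h, zero_div]
    · rw [JJ_orth _ _ h, zero_div]

lemma mix_int (m n : ℕ) :
    ∫ x in Set.Ioo (-1:ℝ) 1, intLegendreP (m+2) x * jacobiP n 1 1 x =
    if m = n then -4 / (((n:ℝ) + 2) * (2 * n + 3)) else 0 := by
  have : ∀ x ∈ Set.Ioo (-1:ℝ) 1, intLegendreP (m+2) x * jacobiP n 1 1 x =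
      (dF (m+1) m * dF (n+1) (n+2)).eval x * ((2 / (n + 2)) /
        ((2 ^ (m+1) * (m+1).factorial) * (2 ^ (n+1) * (n+1).factorial))) := by
    intro x hx; rw [intLeg_eq, jac_eq n x hx, Polynomial.eval_mul]; ring
  rw [setIntegral_congr_fun measurableSet_Ioo this, integral_mul_const, Ioo_JJ]
  have h1 := JJ_parts (m+1) m (by omega) (dF (n+1) (n+1))
  rw [← dF_succ] at h1
  rw [show JJ (dF (m+1) m * dF (n+1) (n+2)) = - JJ (dF (m+1) (m+1) * dF (n+1) (n+1)) by
    rw [h1]; ring]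
  split_ifs with h
  · subst h
    rw [JJ_norm]; push_cast; field_simp; ring
  · rcases Nat.lt_or_gt_of_ne h with h | h
    · rw [mul_comm (dF _ _), JJ_orth _ _ (by omega)]; simp
    · rw [JJ_orth _ _ (by omega)]; simp

lemma sq_int (f g : ℝ → ℝ) : ∫ p in Sq, f p.1 * g p.2 =
    (∫ x in Set.Ioo (-1:ℝ) 1, f x) * ∫ y in Set.Ioo (-1:ℝ) 1, g y :=
  setIntegral_prod_mul f g _ _

lemma int_I (i j k l : ℕ) : ∫ p in Sq, dot2 (vtSqI (i+1) (j+2) p) (btSqI (k+1) (l+2) p) =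
    (if i = k then 2 / (2 * (k:ℝ) + 1) else 0) *
    (if j = l then -4 / (((l:ℝ) + 2) * (2 * l + 3)) else 0) := by
  rw [← leg_int, ← mix_int, ← sq_int]
  congr 1; funext p
  simp [dot2, vtSqI, btSqI]; ring

lemma int_II (i j k l : ℕ) : ∫ p in Sq, dot2 (vtSqII (i+2) (j+1) p) (btSqII (k+2) (l+1) p) =
    (if i = k then -4 / (((k:ℝ) + 2) * (2 * k + 3)) else 0) *
    (if j = l then 2 / (2 * (l:ℝ) + 1) else 0) := by
  rw [← leg_int, ← mix_int, ← sq_int]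
  congr 1; funext p
  simp [dot2, vtSqII, btSqII]; ring

/-- Biorthogonality of the auxiliary `H(curl)` interior fields on the square and
the dual candidates, with the diagonal values. -/
theorem square_Hcurl_aux_biorthogonal (i j k l : ℕ) :
    (1 ≤ i → 2 ≤ j → 1 ≤ k → 2 ≤ l → (i, j) ≠ (k, l) →
      ∫ p in Sq, dot2 (vtSqI i j p) (btSqI k l p) = 0) ∧
    (1 ≤ i → 2 ≤ j → 2 ≤ k → 1 ≤ l →
      ∫ p in Sq, dot2 (vtSqI i j p) (btSqII k l p) = 0) ∧
    (2 ≤ i → 1 ≤ j → 1 ≤ k → 2 ≤ l →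
      ∫ p in Sq, dot2 (vtSqII i j p) (btSqI k l p) = 0) ∧
    (2 ≤ i → 1 ≤ j → 2 ≤ k → 1 ≤ l → (i, j) ≠ (k, l) →
      ∫ p in Sq, dot2 (vtSqII i j p) (btSqII k l p) = 0) ∧
    (1 ≤ i → 2 ≤ j →
      ∫ p in Sq, dot2 (vtSqI i j p) (btSqI i j p) =
        -8 / ((2*(i:ℝ) - 1) * (j:ℝ) * (2*(j:ℝ) - 1))) ∧
    (2 ≤ i → 1 ≤ j →
      ∫ p in Sq, dot2 (vtSqII i j p) (btSqII i j p) =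
        -8 / ((i:ℝ) * (2*(i:ℝ) - 1) * (2*(j:ℝ) - 1))) := by
  refine ⟨?_, ?_, ?_, ?_, ?_, ?_⟩
  · intro hi hj hk hl hne
    obtain ⟨i, rfl⟩ := Nat.exists_eq_add_of_le' hi
    obtain ⟨j, rfl⟩ := Nat.exists_eq_add_of_le' hj
    obtain ⟨k, rfl⟩ := Nat.exists_eq_add_of_le' hk
    obtain ⟨l, rfl⟩ := Nat.exists_eq_add_of_le' hl
    rw [int_I]
    split_ifs with h1 h2
    · subst h1; subst h2; exact absurd rfl hne
    all_goals simp
  · intros; simp [dot2, vtSqI, btSqII]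
  · intros; simp [dot2, vtSqII, btSqI]
  · intro hi hj hk hl hne
    obtain ⟨i, rfl⟩ := Nat.exists_eq_add_of_le' hi
    obtain ⟨j, rfl⟩ := Nat.exists_eq_add_of_le' hj
    obtain ⟨k, rfl⟩ := Nat.exists_eq_add_of_le' hk
    obtain ⟨l, rfl⟩ := Nat.exists_eq_add_of_le' hl
    rw [int_II]
    split_ifs with h1 h2
    · subst h1; subst h2; exact absurd rfl hne
    all_goals simp
  · intro hi hj
    obtain ⟨i, rfl⟩ := Nat.exists_eq_add_of_le' hi
    obtain ⟨j, rfl⟩ := Nat.exists_eq_add_of_le' hj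
    rw [int_I, if_pos rfl, if_pos rfl, div_mul_div_comm]
    push_cast
    congr 1 <;> ring
  · intro hi hj
    obtain ⟨i, rfl⟩ := Nat.exists_eq_add_of_le' hi
    obtain ⟨j, rfl⟩ := Nat.exists_eq_add_of_le' hj
    rw [int_II, if_pos rfl, if_pos rfl, div_mul_div_comm]
    push_cast
    congr 1 <;> ring
end

section
/- For all integers i ≥ 0 and k ≥ 0: ∫_{−1}^{1} L_i(x) P_k^{(1,1)}(x) dx = 4/(2+k) if k ≥ i and k − i is even, and ∫_{−1}^{1} L_i(x) P_k^{(1,1)}(x) dx = 0 otherwise. -/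
open MeasureTheory

open Polynomial in
lemma ljX (y : ℝ[X]) (m : ℕ) : derivative^[m+1] (X * y) =
    X * derivative^[m+1] y + C ((m:ℝ)+1) * derivative^[m] y := by
  induction m with
  | zero => simp [add_comm]
  | succ m ih =>
    rw [Function.iterate_succ_apply', ih]
    simp only [derivative_add, derivative_mul, derivative_X, derivative_C,
      ← Function.iterate_succ_apply' (⇑derivative)]
    simp only [Nat.cast_add, Nat.cast_one, C_add, C_1]
    ring

open Polynomial in
lemma ljU (y : ℝ[X]) (m : ℕ) : derivative^[m+1] ((X^2-1) * derivative y) =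
    (X^2-1) * derivative^[m+2] y + C (2*((m:ℝ)+1)) * X * derivative^[m+1] y
      + C (((m:ℝ)+1)*m) * derivative^[m] y := by
  induction m with
  | zero => simp [C_ofNat]; ring
  | succ m ih =>
    rw [Function.iterate_succ_apply', ih]
    simp only [derivative_add, derivative_sub, derivative_mul, derivative_X, derivative_C,
      derivative_X_pow, derivative_one,
      ← Function.iterate_succ_apply' (⇑derivative)]
    simp only [Nat.cast_add, Nat.cast_one, C_add, C_1, C_mul, C_ofNat, Nat.cast_ofNat]
    ring

open Polynomial in
lemma ljKey (k : ℕ) : (X^2-1 : ℝ[X]) * derivative^[k+2] ((X^2-1)^(k+1)) =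
    C (((k:ℝ)+1)*(k+2)) * derivative^[k] ((X^2-1)^(k+1)) := by
  have h : (X^2-1 : ℝ[X]) * derivative ((X^2-1)^(k+1)) =
      C (2*((k:ℝ)+1)) * (X * (X^2-1)^(k+1)) := by
    simp only [derivative_pow, derivative_sub, derivative_X, derivative_one, C_mul, C_add, C_1,
      Nat.cast_add, Nat.cast_one, C_ofNat, Nat.cast_ofNat, Nat.add_sub_cancel]
    ring
  have h1 := ljU ((X^2-1)^(k+1)) k
  rw [h, iterate_derivative_C_mul, ljX] at h1
  simp only [C_mul, C_add, C_1, C_ofNat] at h1 ⊢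
  linear_combination -h1

open Polynomial in
lemma ljEval (c : ℝ) (n : ℕ) (q : ℝ[X]) :
    (derivative^[n] ((X - C c)^n * q)).eval c = n.factorial * q.eval c := by
  induction n generalizing q with
  | zero => simp
  | succ n ih =>
    have : derivative ((X - C c)^(n+1) * q) =
        (X - C c)^n * (C ((n:ℝ)+1) * q + (X - C c) * derivative q) := by
      simp only [derivative_mul, derivative_pow, derivative_sub, derivative_X, derivative_C, C_add,
        C_1, Nat.cast_add, Nat.cast_one, Nat.add_sub_cancel]
      ring
    rw [Function.iterate_succ_apply, this, ih]
    simp [Nat.factorial_succ]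
    ring

open Polynomial in
lemma ljParts (p q : ℝ[X]) : ∫ x in (-1:ℝ)..1, p.eval x * (derivative q).eval x =
    p.eval 1 * q.eval 1 - p.eval (-1) * q.eval (-1)
      - ∫ x in (-1:ℝ)..1, (derivative p).eval x * q.eval x := by
  apply intervalIntegral.integral_mul_deriv_eq_deriv_mul (u := fun x => p.eval x) (v := fun x => q.eval x) (u' := fun x => (derivative p).eval x) (v' := fun x => (derivative q).eval x)
  · intro x _; exact p.hasDerivAt x
  · intro x _; exact q.hasDerivAt x
  · exact (derivative p).continuous.intervalIntegrable _ _
  · exact (derivative q).continuous.intervalIntegrable _ _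

open Polynomial in
lemma ljOrth (n j : ℕ) (hj : j ≤ n) (q : ℝ[X]) (hq : derivative^[j] q = 0) :
    ∫ x in (-1:ℝ)..1, q.eval x * (derivative^[j] ((X^2-1)^n)).eval x = 0 := by
  induction j generalizing q with
  | zero => simp at hq; simp [hq]
  | succ j ih =>
    have hb : ∀ c : ℝ, c^2 = 1 → (derivative^[j] ((X^2-1 : ℝ[X])^n)).eval c = 0 := by
      intro c hc
      have h1 : (X^2-1 : ℝ[X])^(n-j) ∣ derivative^[j] ((X^2-1 : ℝ[X])^n) :=
        pow_sub_dvd_iterate_derivative_pow _ _ _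
      obtain ⟨r, hr⟩ := h1
      rw [hr]
      have : n - j ≠ 0 := by omega
      simp [hc, this]
    rw [Function.iterate_succ_apply', ljParts, hb 1 (by norm_num), hb (-1) (by norm_num),
      ih (by omega) _ (by rwa [Function.iterate_succ_apply] at hq)]
    simp

open Polynomial in
noncomputable def ljL (n : ℕ) : ℝ[X] :=
  C (1 / ((2:ℝ)^n * (n.factorial : ℝ))) * derivative^[n] ((X^2-1)^n)

open Polynomial in
lemma ljIter (p : ℝ[X]) (n : ℕ) : iteratedDeriv n (fun t => p.eval t) =
    fun t => (derivative^[n] p).eval t := by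
  induction n with
  | zero => simp
  | succ n ih =>
    rw [iteratedDeriv_succ, ih]
    ext x
    rw [Polynomial.deriv, Function.iterate_succ_apply']

open Polynomial in
lemma ljLeg (n : ℕ) (x : ℝ) : legendreP n x = (ljL n).eval x := by
  have := ljIter ((X^2-1)^n) n
  simp only [eval_pow, eval_sub, eval_X, eval_one] at this
  simp [legendreP, jacobiP, ljL, this]

open Polynomial in
lemma ljJac (k : ℕ) (x : ℝ) (h1 : x ≠ 1) (h2 : x ≠ -1) :
    jacobiP k 1 1 x = 2 / (2 + (k:ℝ)) * (derivative (ljL (k+1))).eval x := by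
  have e : (fun t : ℝ => (1 - t)^1 * (1 + t)^1 * (t^2 - 1)^k) =
      fun t => ((-(X^2-1)^(k+1) : ℝ[X])).eval t := by
    ext t; simp; ring
  have hk := congrArg (eval x) (ljKey k)
  simp only [eval_mul, eval_sub, eval_pow, eval_X, eval_one, eval_C] at hk
  rw [jacobiP, e, ljIter]
  simp only [ljL, derivative_C_mul, iterate_derivative_neg, eval_neg, eval_mul, eval_C,
    ← Function.iterate_succ_apply' (⇑derivative)]
  have a1 : 1 - x ≠ 0 := sub_ne_zero.2 h1.symm
  have a2 : 1 + x ≠ 0 := fun h => h2 (by linarith)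
  have a3 : (2:ℝ) + k ≠ 0 := by positivity
  have a4 : (1:ℝ) + k ≠ 0 := by positivity
  have a5 : (k:ℝ) + 1 ≠ 0 := by positivity
  have a6 : (k.factorial : ℝ) ≠ 0 := by positivity
  rw [show (k+1).succ = k+2 from rfl]
  generalize eval x (derivative^[k+2] ((X^2-1 : ℝ[X])^(k+1))) = A at *
  generalize eval x (derivative^[k] ((X^2-1 : ℝ[X])^(k+1))) = B at *
  simp only [Nat.factorial_succ, Nat.cast_mul, Nat.cast_add, Nat.cast_one, pow_succ, pow_zero,
    one_mul]
  field_simp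
  linear_combination hk

open Polynomial in
lemma ljL_one (n : ℕ) : (ljL n).eval 1 = 1 := by
  have e : (X^2-1 : ℝ[X])^n = (X - C 1)^n * (X+1)^n := by
    rw [← mul_pow]; congr 1; simp; ring
  have a6 : (n.factorial : ℝ) ≠ 0 := by positivity
  rw [ljL, e, eval_mul, ljEval]
  simp only [eval_C, eval_pow, eval_add, eval_X, eval_one]
  norm_num
  field_simp

open Polynomial in
lemma ljL_neg_one (n : ℕ) : (ljL n).eval (-1) = (-1)^n := by
  have e : (X^2-1 : ℝ[X])^n = (X - C (-1))^n * (X-1)^n := by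
    rw [← mul_pow]; congr 1; simp; ring
  have a6 : (n.factorial : ℝ) ≠ 0 := by positivity
  rw [ljL, e, eval_mul, ljEval]
  simp only [eval_C, eval_pow, eval_sub, eval_X, eval_one]
  rw [show (-1 - 1 : ℝ) = (-1) * 2 by norm_num, mul_pow]
  field_simp

open Polynomial in
lemma ljL_deg (n : ℕ) : (ljL n).natDegree ≤ n := by
  refine (natDegree_C_mul_le _ _).trans ((natDegree_iterate_derivative _ _).trans ?_)
  have : ((X^2-1 : ℝ[X])^n).natDegree ≤ n * 2 := by
    refine natDegree_pow_le_of_le _ ?_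
    compute_degree
  omega

open Polynomial in
lemma ljOrth' (n : ℕ) (q : ℝ[X]) (hq : derivative^[n] q = 0) :
    ∫ x in (-1:ℝ)..1, q.eval x * (ljL n).eval x = 0 := by
  have := ljOrth n n le_rfl q hq
  simp only [ljL, eval_mul, eval_C, mul_left_comm (eval _ q)]
  rw [intervalIntegral.integral_const_mul, this, mul_zero]

/-- Integral of a Legendre polynomial against a Jacobi polynomial `P^{(1,1)}`. -/
theorem legendre_jacobi11_integral (i k : ℕ) :
    ∫ x in (-1:ℝ)..1, legendreP i x * jacobiP k 1 1 x =
      if i ≤ k ∧ Even (k - i) then 4 / (2 + (k:ℝ)) else 0 := by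
  have h0 : ∫ x in (-1:ℝ)..1, legendreP i x * jacobiP k 1 1 x =
      2 / (2 + (k:ℝ)) * ∫ x in (-1:ℝ)..1, (ljL i).eval x *
        (Polynomial.derivative (ljL (k+1))).eval x := by
    rw [← intervalIntegral.integral_const_mul]
    apply intervalIntegral.integral_congr_ae
    have hf : ({1, -1} : Set ℝ).Finite := by simp
    filter_upwards [hf.countable.ae_notMem volume] with x hx _
    simp only [Set.mem_insert_iff, Set.mem_singleton_iff, not_or] at hx
    rw [ljLeg, ljJac k x hx.1 hx.2]
    ring
  rw [h0]
  by_cases hik : i ≤ k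
  · rw [ljParts, ljOrth', ljL_one, ljL_one, ljL_neg_one, ljL_neg_one]
    · by_cases he : Even (k - i)
      · rw [if_pos ⟨hik, he⟩, ← pow_add, Odd.neg_one_pow]
        · ring
        · rw [show i + (k+1) = (k - i) + 2 * i + 1 by omega]
          exact (he.add (even_two_mul i)).add_one
      · rw [if_neg (fun h => he h.2), ← pow_add, Even.neg_one_pow]
        · ring
        · rw [show i + (k+1) = (k - i) + 1 + 2 * i by omega]
          exact ((Nat.not_even_iff_odd.1 he).add_one).add (even_two_mul i)
    · rw [← Function.iterate_succ_apply]
      apply Polynomial.iterate_derivative_eq_zero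
      have := ljL_deg i
      omega
  · rw [if_neg (fun h => hik h.1)]
    simp only [mul_comm (Polynomial.eval _ (ljL i))]
    rw [ljOrth', mul_zero]
    rw [← Function.iterate_succ_apply]
    apply Polynomial.iterate_derivative_eq_zero
    have := ljL_deg (k+1)
    omega
end
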